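/- Let $A$ be a commutative ring, $\mathfrak{m} \subseteq A$ a maximal ideal, and $B$ a flat $A$-module. If $M$ is an $A$-module with $\mathfrak{m}^n M = 0$ for some $n \ge 0$, then $\mathrm{Ext}^p_A(B, M) = 0$ for all $p \ge 1$. -/

import Mathlib

open CategoryTheory

section

variable {A : Type*} [CommRing A]

namespace Module.Flat

/-- A submodule of a flat module is flat if the quotient is flat. -/
theorem of_flat_quotient {P : Type*} [AddCommGroup P] [Module A P] (K : Submodule A P)
    [Module.Flat A P] [Module.Flat A (P ⧸ K)] : Module.Flat A K := by
  have hexact : Function.Exact (CharacterModule.dual K.mkQ) (CharacterModule.dual K.subtype) := by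
    intro c
    constructor
    · intro hc
      refine ⟨QuotientAddGroup.lift K.toAddSubgroup c fun x hx ↦ ?_, ?_⟩
      · exact DFunLike.congr_fun hc (⟨x, hx⟩ : K)
      · ext x
        rfl
    · rintro ⟨c, rfl⟩
      ext x
      have hx : K.mkQ (x : P) = 0 := by simp
      change c (K.mkQ (x : P)) = 0
      rw [hx, map_zero]
  obtain ⟨r, hr⟩ := (iff_characterModule_baer.mp ‹Module.Flat A (P ⧸ K)›).extension_property
    (CharacterModule.dual K.mkQ)
    (CharacterModule.dual_injective_of_surjective _ K.mkQ_surjective) LinearMap.id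
  obtain ⟨-, s, hs⟩ := (hexact.split_tfae'.out 1 0 rfl rfl).mp
    ⟨CharacterModule.dual_surjective_of_injective _ K.injective_subtype, r, hr⟩
  refine iff_characterModule_baer.mpr fun I g ↦ ?_
  obtain ⟨g', hg'⟩ := iff_characterModule_baer.mp ‹Module.Flat A P› I (s ∘ₗ g)
  refine ⟨CharacterModule.dual K.subtype ∘ₗ g', fun x hx ↦ ?_⟩
  rw [LinearMap.comp_apply, hg' x hx]
  exact LinearMap.congr_fun hs (g ⟨x, hx⟩)

/-- If `P ⧸ K` is flat, then `K ⊓ I P ≤ I K` for every ideal `I`. -/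
theorem mem_smul_top_of_mem_smul_top {P : Type*} [AddCommGroup P] [Module A P]
    (K : Submodule A P) [Module.Flat A (P ⧸ K)] (I : Ideal A) (x : K)
    (hx : (x : P) ∈ I • (⊤ : Submodule A P)) : x ∈ I • (⊤ : Submodule A K) := by
  obtain ⟨a, ha, hax⟩ := (Submodule.mem_ideal_smul_span_iff_exists_sum I (id : P → P) x).mp
    (by simpa using hx)
  let S := {y // y ∈ a.support}
  have hsum : ∑ i : S, a i • (i : P) = x := by
    rw [← hax, Finsupp.sum]
    exact Finset.sum_coe_sort a.support fun i ↦ a i • i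
  obtain ⟨k, b, y, hy, hb⟩ := isTrivialRelation_of_sum_smul_eq_zero (R := A) (M := P ⧸ K)
    (f := fun i : S ↦ a i) (x := fun i : S ↦ K.mkQ i) (by
      simp only [← map_smul, ← map_sum, hsum]
      simp)
  choose z hz using fun j ↦ K.mkQ_surjective (y j)
  have hmem (i : S) : (i : P) - ∑ j, b i j • z j ∈ K := by
    rw [← K.ker_mkQ, LinearMap.mem_ker, map_sub, sub_eq_zero]
    simpa only [map_sum, map_smul, hz] using hy i
  have hx' : x = ∑ i : S, a i • (⟨_, hmem i⟩ : K) := by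
    apply Subtype.ext
    have h0 : ∑ i : S, a i • ∑ j, b i j • z j = 0 := by
      simp only [Finset.smul_sum, smul_smul]
      rw [Finset.sum_comm]
      simp only [← Finset.sum_smul, hb, zero_smul, Finset.sum_const_zero]
    simp only [AddSubmonoidClass.coe_finsetSum, Submodule.coe_smul, smul_sub,
      Finset.sum_sub_distrib, h0, hsum, sub_zero]
  rw [hx']
  exact Submodule.sum_mem _ fun i _ ↦ Submodule.smul_mem_smul (ha i) trivial

end Module.Flat

/-- Linear maps extend along injections into a semisimple module. -/
theorem IsSemisimpleModule.exists_extension {M N Q : Type*} [AddCommGroup M] [Module A M]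
    [AddCommGroup N] [Module A N] [AddCommGroup Q] [Module A Q] [IsSemisimpleModule A N]
    (i : M →ₗ[A] N) (hi : Function.Injective i) (f : M →ₗ[A] Q) :
    ∃ g : N →ₗ[A] Q, g ∘ₗ i = f := by
  obtain ⟨C, hC⟩ := exists_isCompl (LinearMap.range i)
  refine ⟨f ∘ₗ (LinearEquiv.ofInjective i hi).symm.toLinearMap ∘ₗ
    Submodule.projectionOnto _ C hC, ?_⟩
  ext x
  have : Submodule.projectionOnto _ C hC (i x) = LinearEquiv.ofInjective i hi x :=
    Submodule.projectionOnto_apply_left hC (LinearEquiv.ofInjective i hi x)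
  simp [this]

namespace Module.Flat

variable {P : Type*} [AddCommGroup P] [Module A P] (K : Submodule A P) [Module.Flat A (P ⧸ K)]
  (m : Ideal A) [m.IsMaximal]

/-- If `P ⧸ K` is flat, then every map from `K` to a module killed by a maximal ideal extends
to `P`. -/
theorem exists_extension_of_smul_eq_bot {Q : Type*} [AddCommGroup Q] [Module A Q]
    (hQ : m • (⊤ : Submodule A Q) = ⊥) (f : K →ₗ[A] Q) :
    ∃ g : P →ₗ[A] Q, g ∘ₗ K.subtype = f := by
  let := Ideal.Quotient.field m
  have : IsSemisimpleModule A (P ⧸ m • (⊤ : Submodule A P)) :=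
    ((Module.isTorsionBySet_quotient_ideal_smul P m).isSemisimpleModule_iff).mp inferInstance
  let i : (K ⧸ m • (⊤ : Submodule A K)) →ₗ[A] (P ⧸ m • (⊤ : Submodule A P)) :=
    Submodule.mapQ _ _ K.subtype
      (Submodule.map_le_iff_le_comap.mp (by
        rw [Submodule.map_smul'']
        exact Submodule.smul_mono le_rfl le_top))
  have hi : Function.Injective i := by
    rw [← LinearMap.ker_eq_bot, eq_bot_iff]
    intro x hx
    obtain ⟨x, rfl⟩ := Submodule.mkQ_surjective _ x
    rw [LinearMap.mem_ker, Submodule.mkQ_apply, Submodule.mapQ_apply,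
      Submodule.Quotient.mk_eq_zero] at hx
    exact (Submodule.Quotient.mk_eq_zero _).mpr (mem_smul_top_of_mem_smul_top K m x hx)
  obtain ⟨g, hg⟩ := IsSemisimpleModule.exists_extension i hi
    (Submodule.liftQ (m • ⊤) f (by
      rw [LinearMap.le_ker_iff_map, Submodule.map_smul'', eq_bot_iff, ← hQ]
      exact Submodule.smul_mono le_rfl le_top))
  refine ⟨g ∘ₗ Submodule.mkQ _, ?_⟩
  ext x
  exact LinearMap.congr_fun hg (Submodule.Quotient.mk x)

/-- If `P` is projective and `P ⧸ K` is flat, then every map from `K` to a module killed by a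
power of a maximal ideal extends to `P`. -/
theorem exists_extension_of_pow_smul_eq_bot [Module.Projective A P] {M : Type*} [AddCommGroup M]
    [Module A M] (n : ℕ) (hM : m ^ n • (⊤ : Submodule A M) = ⊥) (f : K →ₗ[A] M) :
    ∃ g : P →ₗ[A] M, g ∘ₗ K.subtype = f := by
  suffices H : ∀ j : ℕ, ∃ g : P →ₗ[A] M, ∀ x : K, f x - g x ∈ m ^ j • (⊤ : Submodule A M) by
    obtain ⟨g, hg⟩ := H n
    refine ⟨g, ?_⟩
    ext x
    have := hg x
    rw [hM, Submodule.mem_bot, sub_eq_zero] at this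
    exact this.symm
  intro j
  induction j with
  | zero => exact ⟨0, by simp⟩
  | succ j ih =>
    obtain ⟨g, hg⟩ := ih
    let N : Submodule A M := m ^ j • ⊤
    let h : K →ₗ[A] N := (f - g ∘ₗ K.subtype).codRestrict N hg
    obtain ⟨u, hu⟩ := exists_extension_of_smul_eq_bot K m (Q := N ⧸ m • (⊤ : Submodule A N))
      (by
        rw [eq_bot_iff, Submodule.smul_le]
        intro r hr x _
        exact Module.isTorsionBySet_quotient_ideal_smul N m (x := x) (a := ⟨r, hr⟩))
      (Submodule.mkQ _ ∘ₗ h)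
    obtain ⟨v, hv⟩ := Module.projective_lifting_property (Submodule.mkQ _) u
      (Submodule.mkQ_surjective _)
    refine ⟨g + N.subtype ∘ₗ v, fun x ↦ ?_⟩
    have hx : h x - v x ∈ m • (⊤ : Submodule A N) := by
      rw [← Submodule.ker_mkQ (m • (⊤ : Submodule A N)), LinearMap.mem_ker, map_sub, sub_eq_zero]
      exact (LinearMap.congr_fun hu x).symm.trans (LinearMap.congr_fun hv (x : P)).symm
    have := Submodule.mem_map_of_mem (f := N.subtype) hx
    rw [Submodule.map_smul'', Submodule.map_subtype_top] at this
    rw [pow_succ', Submodule.mul_smul]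
    change f x - (g x + v x) ∈ _
    rw [← sub_sub]
    exact this

end Module.Flat

end

namespace CategoryTheory.ProjectiveResolution

universe u v

variable {A : Type u} [CommRing A] {B : ModuleCat.{v} A} (P : ProjectiveResolution B)

theorem range_d_one_eq_ker :
    LinearMap.range (P.complex.d 1 0).hom = LinearMap.ker (P.π.f 0).hom :=
  P.exact₀.moduleCat_range_eq_ker

theorem range_d_succ_eq_ker (n : ℕ) :
    LinearMap.range (P.complex.d (n + 2) (n + 1)).hom =
      LinearMap.ker (P.complex.d (n + 1) n).hom :=
  (P.exact_succ n).moduleCat_range_eq_ker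

variable [Small.{v} A]

instance module_projective_X (n : ℕ) : Module.Projective A (P.complex.X n) :=
  ModuleCat.projective_of_module_projective _

/-- The syzygies of a flat module are flat. -/
theorem flat_quotient_range_d [Module.Flat A B] (n : ℕ) :
    Module.Flat A (P.complex.X n ⧸ LinearMap.range (P.complex.d (n + 1) n).hom) := by
  induction n with
  | zero =>
    rw [range_d_one_eq_ker]
    have : Module.Flat A (((ChainComplex.single₀ (ModuleCat A)).obj B).X 0) :=
      ‹Module.Flat A B›
    exact .of_linearEquiv ((P.π.f 0).hom.quotKerEquivOfSurjective
      ((ModuleCat.epi_iff_surjective _).mp inferInstance))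
  | succ n ih =>
    rw [range_d_succ_eq_ker]
    have := Module.Flat.of_flat_quotient (LinearMap.range (P.complex.d (n + 1) n).hom)
    exact .of_linearEquiv (LinearMap.quotKerEquivRange _)

end CategoryTheory.ProjectiveResolution

/-- Let `A` be a commutative ring, `m ⊆ A` a maximal ideal, and `B` a flat `A`-module. If `M` is
an `A`-module with `m^n M = 0` for some `n ≥ 0`, then `Ext^p_A(B, M) = 0` for all `p ≥ 1`. -/
theorem ext_eq_zero_of_flat_of_torsion (A : Type) [CommRing A] (m : Ideal A) [m.IsMaximal]
    (B : Type) [AddCommGroup B] [Module A B] [Module.Flat A B]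
    (M : Type) [AddCommGroup M] [Module A M]
    (n : ℕ) (hM : m ^ n • (⊤ : Submodule A M) = ⊥)
    (p : ℕ) (hp : 1 ≤ p) :
    Subsingleton (((Ext A (ModuleCat A) p).obj
      (Opposite.op (ModuleCat.of A B))).obj (ModuleCat.of A M)) := by
  obtain ⟨p, rfl⟩ := Nat.exists_eq_add_of_le' hp
  let P := projectiveResolution (ModuleCat.of A B)
  apply ModuleCat.subsingleton_of_isZero
  refine Limits.IsZero.of_iso ?_ (P.isoExt (p + 1) (ModuleCat.of A M))
  rw [← HomologicalComplex.exactAt_iff_isZero_homology,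
    HomologicalComplex.exactAt_iff' _ p (p + 1) (p + 2) (by simp) (by simp),
    ShortComplex.moduleCat_exact_iff]
  intro (f : P.complex.X (p + 1) ⟶ ModuleCat.of A M) hf
  replace hf : P.complex.d (p + 2) (p + 1) ≫ f = 0 := hf
  let d := (P.complex.d (p + 1) p).hom
  have hker : LinearMap.ker d ≤ LinearMap.ker f.hom := by
    rw [← P.range_d_succ_eq_ker, LinearMap.range_le_ker_iff, ← ModuleCat.hom_comp, hf]
    rfl
  have := P.flat_quotient_range_d p
  obtain ⟨g, hg⟩ := Module.Flat.exists_extension_of_pow_smul_eq_bot (LinearMap.range d) m n hM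
    ((LinearMap.ker d).liftQ f.hom hker ∘ₗ d.quotKerEquivRange.symm.toLinearMap)
  refine ⟨ModuleCat.ofHom g, ?_⟩
  change P.complex.d (p + 1) p ≫ ModuleCat.ofHom g = f
  ext x
  have hx := LinearMap.congr_fun hg (d.quotKerEquivRange (Submodule.Quotient.mk x))
  simpa using hx
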